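/- arXiv:2109.03861 — 5 statements merged into one kernel-verified Lean document; each statement's English description precedes it below -/
import Mathlib

section
/- Let A ∈ ℝ^{n×n}, B ∈ ℝ^{n×m}, C ∈ ℝ^{m×n}, D ∈ ℝ^{m×m}, let 0 ≤ ρ ≤ 1, let P̄ ∈ ℝ^{n×n} be symmetric and Λ̄ ∈ ℝ^{m×m} be diagonal, and suppose there exist a symmetric positive definite Q₁ ∈ ℝ^{n×n} and a diagonal positive definite Q₂ ∈ ℝ^{m×m} such that the 4×4 block matrix [[ρ²(2P̄ − P̄ᵀQ₁P̄), 0, Aᵀ, Cᵀ], [0, 2Λ̄ − Λ̄ᵀQ₂Λ̄, Bᵀ, Dᵀ], [A, B, Q₁, 0], [C, D, 0, Q₂]] is positive semidefinite. Then, setting P = Q₁⁻¹ and Λ = Q₂⁻¹, the matrix [[AᵀPA − ρ²P, AᵀPB], [BᵀPA, BᵀPB]] + [[C, D], [0, I_m]]ᵀ [[Λ, 0], [0, −Λ]] [[C, D], [0, I_m]] is negative semidefinite. -/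
open Matrix

theorem Matrix.PosDef.conjTranspose_one_sub_mul_inv_mul {k : Type*} [Fintype k] [DecidableEq k]
    {Q X : Matrix k k ℝ} (hQ : Q.PosDef) (hX : X.IsSymm) :
    (1 - Q * X)ᴴ * Q⁻¹ * (1 - Q * X) = Q⁻¹ - ((2 : ℝ) • X - Xᵀ * Q * X) := by
  have hdet : IsUnit Q.det := (isUnit_iff_isUnit_det Q).1 hQ.isUnit
  have hleft (Y : Matrix k k ℝ) : Q⁻¹ * (Q * Y) = Y := nonsing_inv_mul_cancel_left _ _ hdet
  rw [conjTranspose_sub, conjTranspose_mul, hQ.isHermitian.eq, conjTranspose_one,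
    conjTranspose_eq_transpose_of_trivial, hX.eq, two_smul]
  simp only [sub_mul, mul_sub, one_mul, mul_one, Matrix.mul_assoc, hleft,
    mul_nonsing_inv _ hdet]
  abel

theorem Matrix.inv_fromBlocks_zero_zero {k l : Type*} [Fintype k] [DecidableEq k]
    [Fintype l] [DecidableEq l] {P : Matrix k k ℝ} {Q : Matrix l l ℝ}
    (hP : IsUnit P) (hQ : IsUnit Q) :
    (fromBlocks P 0 0 Q)⁻¹ = fromBlocks P⁻¹ 0 0 Q⁻¹ := by
  refine inv_eq_right_inv ?_
  simp [fromBlocks_multiply, mul_nonsing_inv _ ((isUnit_iff_isUnit_det _).1 hP),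
    mul_nonsing_inv _ ((isUnit_iff_isUnit_det _).1 hQ)]

theorem Matrix.PosDef.fromBlocks_zero_zero {k l : Type*} [Fintype k] [DecidableEq k]
    [Fintype l] [DecidableEq l] {P : Matrix k k ℝ} {Q : Matrix l l ℝ}
    (hP : P.PosDef) (hQ : Q.PosDef) : (fromBlocks P 0 0 Q).PosDef := by
  have := hP.isUnit.invertible
  have hsemi : (fromBlocks P 0 0ᴴ Q).PosSemidef :=
    (PosDef.fromBlocks₁₁ 0 Q hP).2 (by simpa using hQ.posSemidef)
  rw [conjTranspose_zero] at hsemi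
  refine hsemi.posDef_iff_isUnit.2 ?_
  rw [isUnit_iff_isUnit_det, det_fromBlocks_zero₂₁]
  exact ((isUnit_iff_isUnit_det _).1 hP.isUnit).mul ((isUnit_iff_isUnit_det _).1 hQ.isUnit)

/-- Sequential convexification (matrix form): feasibility of the convex LMI
certificate implies the nonconvex Lyapunov/S-procedure matrix inequality. -/
theorem lmi_implies_lyapunov_inequality (n m : ℕ)
    (A : Matrix (Fin n) (Fin n) ℝ) (B : Matrix (Fin n) (Fin m) ℝ)
    (C : Matrix (Fin m) (Fin n) ℝ) (D : Matrix (Fin m) (Fin m) ℝ)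
    (ρ : ℝ) (hρ0 : 0 ≤ ρ) (hρ1 : ρ ≤ 1)
    (Pb : Matrix (Fin n) (Fin n) ℝ) (hPb : Pb.IsHermitian)
    (Λb : Matrix (Fin m) (Fin m) ℝ) (hΛb : Λb.IsDiag)
    (Q₁ : Matrix (Fin n) (Fin n) ℝ) (hQ₁ : Q₁.PosDef)
    (Q₂ : Matrix (Fin m) (Fin m) ℝ) (hQ₂diag : Q₂.IsDiag) (hQ₂ : Q₂.PosDef)
    (hLMI : (fromBlocks
        (fromBlocks ((ρ ^ 2) • ((2 : ℝ) • Pb - Pbᵀ * Q₁ * Pb)) 0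
                    0 ((2 : ℝ) • Λb - Λbᵀ * Q₂ * Λb))
        (fromBlocks Aᵀ Cᵀ Bᵀ Dᵀ)
        (fromBlocks A B C D)
        (fromBlocks Q₁ 0 0 Q₂)).PosSemidef) :
    (-(fromBlocks (Aᵀ * Q₁⁻¹ * A - (ρ ^ 2) • Q₁⁻¹) (Aᵀ * Q₁⁻¹ * B)
        (Bᵀ * Q₁⁻¹ * A) (Bᵀ * Q₁⁻¹ * B)
      + (fromBlocks C D 0 (1 : Matrix (Fin m) (Fin m) ℝ))ᵀ
        * (fromBlocks Q₂⁻¹ 0 0 (-Q₂⁻¹))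
        * (fromBlocks C D 0 (1 : Matrix (Fin m) (Fin m) ℝ)))).PosSemidef := by
  have hQ := hQ₁.fromBlocks_zero_zero hQ₂
  have := hQ.isUnit.invertible
  have htr : fromBlocks A B C D = (fromBlocks Aᵀ Cᵀ Bᵀ Dᵀ)ᴴ := by
    simp [conjTranspose_eq_transpose_of_trivial, fromBlocks_transpose]
  rw [htr] at hLMI
  have hschur := (PosDef.fromBlocks₂₂ _ _ hQ).1 hLMI
  rw [← htr] at hschur
  have hgap := hQ.inv.posSemidef.conjTranspose_mul_mul_same
    (fromBlocks (ρ • (1 - Q₁ * Pb)) 0 0 (1 - Q₂ * Λb))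
  have hblock₁ := hQ₁.conjTranspose_one_sub_mul_inv_mul (X := Pb)
    (by simpa [IsHermitian, IsSymm, conjTranspose_eq_transpose_of_trivial] using hPb)
  have hblock₂ := hQ₂.conjTranspose_one_sub_mul_inv_mul hΛb.isSymm
  rw [inv_fromBlocks_zero_zero hQ₁.isUnit hQ₂.isUnit] at hschur hgap
  simp only [fromBlocks_conjTranspose, fromBlocks_multiply, conjTranspose_smul, conjTranspose_zero,
    Matrix.zero_mul, Matrix.mul_zero, add_zero, zero_add, Matrix.smul_mul, Matrix.mul_smul,
    smul_smul, smul_zero, hblock₁, hblock₂, star_trivial] at hgap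
  refine (congrArg PosSemidef ?_).mpr (hschur.add hgap)
  simp only [fromBlocks_transpose, fromBlocks_multiply, fromBlocks_add, fromBlocks_neg,
    sub_eq_add_neg, Matrix.zero_mul, Matrix.mul_zero, Matrix.mul_one, Matrix.one_mul,
    transpose_zero, transpose_one, add_zero, zero_add, Matrix.mul_neg, pow_two]
  rw [fromBlocks_inj]
  refine ⟨?_, ?_, ?_, ?_⟩
  · module
  · abel
  · abel
  · abel
end

section
/- Let A ∈ ℝ^{n×n}, B ∈ ℝ^{n×m}, C ∈ ℝ^{m×n}, D ∈ ℝ^{m×m}, let ρ ≥ 0, let P ∈ ℝ^{n×n} be symmetric positive semidefinite and Λ ∈ ℝ^{m×m} diagonal positive semidefinite, and suppose the matrix [[AᵀPA − ρ²P, AᵀPB], [BᵀPA, BᵀPB]] + [[C, D], [0, I_m]]ᵀ [[Λ, 0], [0, −Λ]] [[C, D], [0, I_m]] is negative semidefinite. Let ζ : ℕ → ℝⁿ and z, v : ℕ → ℝ^m be sequences satisfying ζ(k+1) = A ζ(k) + B z(k), v(k) = C ζ(k) + D z(k), and z_i(k)² ≤ v_i(k)² for every component i and every k (i.e. z(k)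 = φ̃(v(k)) for an elementwise function φ̃ sector bounded in [−1, 1]). Then for all k ∈ ℕ, ζ(k+1)ᵀ P ζ(k+1) ≤ ρ² · ζ(k)ᵀ P ζ(k). -/
open Matrix

theorem Matrix.dotProduct_transpose_mul_mul_mulVec {l m n o R : Type*} [CommSemiring R]
    [Fintype l] [Fintype m] [Fintype n] [Fintype o] (M : Matrix l m R) (Q : Matrix l n R)
    (N : Matrix n o R) (x : m → R) (y : o → R) :
    x ⬝ᵥ ((Mᵀ * Q * N) *ᵥ y) = (M *ᵥ x) ⬝ᵥ (Q *ᵥ (N *ᵥ y)) := by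
  rw [← mulVec_mulVec, ← mulVec_mulVec, dotProduct_mulVec, vecMul_transpose]

/-- The quadratic form of a diagonal positive semidefinite matrix is monotone in the squares of
the coordinates. -/
theorem Matrix.IsDiag.dotProduct_mulVec_le_of_sq_le {m : Type*} [Fintype m] [DecidableEq m]
    {Λ : Matrix m m ℝ} (hdiag : Λ.IsDiag) (hΛ : Λ.PosSemidef) {x y : m → ℝ}
    (h : ∀ i, x i ^ 2 ≤ y i ^ 2) : x ⬝ᵥ (Λ *ᵥ x) ≤ y ⬝ᵥ (Λ *ᵥ y) := by
  rw [← hdiag.diagonal_diag]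
  simp only [dotProduct, mulVec_diagonal, diag_apply]
  refine Finset.sum_le_sum fun i _ => ?_
  have := mul_le_mul_of_nonneg_left (h i) (hΛ.diag_nonneg (i := i))
  linarith

/-- Lyapunov decrease along trajectories of a linear system in feedback with an
elementwise sector-`[−1,1]` nonlinearity, given the Lyapunov/S-procedure matrix
inequality. -/
theorem lyapunov_decrease_along_trajectories (n m : ℕ)
    (A : Matrix (Fin n) (Fin n) ℝ) (B : Matrix (Fin n) (Fin m) ℝ)
    (C : Matrix (Fin m) (Fin n) ℝ) (D : Matrix (Fin m) (Fin m) ℝ)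
    (ρ : ℝ) (hρ0 : 0 ≤ ρ)
    (P : Matrix (Fin n) (Fin n) ℝ) (hPsym : P.IsHermitian) (hP : P.PosSemidef)
    (Λ : Matrix (Fin m) (Fin m) ℝ) (hΛdiag : Λ.IsDiag) (hΛ : Λ.PosSemidef)
    (hmat : (-(fromBlocks (Aᵀ * P * A - (ρ ^ 2) • P) (Aᵀ * P * B)
        (Bᵀ * P * A) (Bᵀ * P * B)
      + (fromBlocks C D 0 (1 : Matrix (Fin m) (Fin m) ℝ))ᵀ
        * (fromBlocks Λ 0 0 (-Λ))
        * (fromBlocks C D 0 (1 : Matrix (Fin m) (Fin m) ℝ)))).PosSemidef)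
    (ζ : ℕ → Fin n → ℝ) (z v : ℕ → Fin m → ℝ)
    (hdyn : ∀ k, ζ (k + 1) = A *ᵥ ζ k + B *ᵥ z k)
    (hout : ∀ k, v k = C *ᵥ ζ k + D *ᵥ z k)
    (hsec : ∀ k, ∀ i, (z k i) ^ 2 ≤ (v k i) ^ 2) :
    ∀ k, ζ (k + 1) ⬝ᵥ (P *ᵥ ζ (k + 1)) ≤ ρ ^ 2 * (ζ k ⬝ᵥ (P *ᵥ ζ k)) := by
  intro k
  have hS := hΛdiag.dotProduct_mulVec_le_of_sq_le hΛ (hsec k)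
  have hM := hmat.dotProduct_mulVec_nonneg (Sum.elim (ζ k) (z k))
  rw [star_trivial, neg_mulVec, dotProduct_neg, add_mulVec, dotProduct_add,
    dotProduct_transpose_mul_mul_mulVec] at hM
  simp only [fromBlocks_mulVec, Sum.elim_comp_inl, Sum.elim_comp_inr, sumElim_dotProduct_sumElim,
    zero_mulVec, one_mulVec, zero_add, add_zero, ← hout k, sub_mulVec, neg_mulVec, smul_mulVec,
    dotProduct_add, dotProduct_sub, dotProduct_neg, dotProduct_smul, smul_eq_mul,
    dotProduct_transpose_mul_mul_mulVec] at hM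
  simp only [hdyn k, mulVec_add, dotProduct_add, add_dotProduct]
  linarith
end

section
/- (Recursive Feasibility.) Let A ∈ ℝ^{n×n}, B ∈ ℝ^{n×m}, C ∈ ℝ^{m×n}, D ∈ ℝ^{m×m} and 0 ≤ ρ ≤ 1. Suppose there exist a symmetric positive definite Q₁ ∈ ℝ^{n×n}, a diagonal positive definite Q₂ ∈ ℝ^{m×m}, a symmetric P̄ ∈ ℝ^{n×n} and a diagonal Λ̄ ∈ ℝ^{m×m} such that the block matrix [[ρ²(2P̄ − P̄ᵀQ₁P̄), 0, Aᵀ, Cᵀ], [0, 2Λ̄ − Λ̄ᵀQ₂Λ̄, Bᵀ, Dᵀ], [A, B, Q₁, 0], [C, D, 0, Q₂]] is positive semidefinite. Then the same LMI holds with P̄ replaced by Q₁⁻¹ and Λ̄ replaced by Q₂⁻¹; that is, [[ρ² Q₁⁻¹, 0, Aᵀ, Cᵀ], [0, Q₂⁻¹, Bᵀ, Dᵀ], [A, B, Q₁, 0], [C, D, 0, Q₂]] is positive semidefinite (note 2(Q₁⁻¹) − Q₁⁻¹Q₁Q₁⁻¹ = Q₁⁻¹ and 2(Q₂⁻¹)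 − Q₂⁻¹Q₂Q₂⁻¹ = Q₂⁻¹). -/
open Matrix

/-- A block diagonal matrix with positive semidefinite blocks is positive semidefinite. -/
theorem posSemidef_fromBlocks_diagonal {k l : Type*} [Fintype k] [Fintype l]
    {M : Matrix k k ℝ} {N : Matrix l l ℝ} (hM : M.PosSemidef) (hN : N.PosSemidef) :
    (fromBlocks M 0 0 N).PosSemidef := by
  refine .of_dotProduct_mulVec_nonneg
    (hM.isHermitian.fromBlocks (by simp) hN.isHermitian) fun x => ?_
  obtain ⟨u, v, rfl⟩ : ∃ u v, x = Sum.elim u v :=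
    ⟨x ∘ Sum.inl, x ∘ Sum.inr, (Sum.elim_comp_inl_inr x).symm⟩
  have hu := hM.dotProduct_mulVec_nonneg u
  have hv := hN.dotProduct_mulVec_nonneg v
  simp only [star_trivial] at hu hv ⊢
  simpa [fromBlocks_mulVec, sumElim_dotProduct_sumElim] using add_nonneg hu hv

/-- The completion of squares `2 P - Pᵀ Q P ⪯ Q⁻¹` for symmetric `P` and `Q ≻ 0`. -/
theorem posSemidef_inv_sub_two_smul_sub {k : Type*} [Fintype k] [DecidableEq k]
    {P Q : Matrix k k ℝ} (hQ : Q.PosDef) (hP : P.IsSymm) :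
    (Q⁻¹ - ((2 : ℝ) • P - Pᵀ * Q * P)).PosSemidef := by
  have hdet : IsUnit Q.det := (isUnit_iff_isUnit_det Q).mp hQ.isUnit
  have hinv : (Q⁻¹)ᴴ = Q⁻¹ := hQ.inv.isHermitian
  have hPH : Pᴴ = P := by rw [conjTranspose_eq_transpose_of_trivial, hP.eq]
  have key : Q⁻¹ - ((2 : ℝ) • P - Pᵀ * Q * P) = (Q⁻¹ - P)ᴴ * Q * (Q⁻¹ - P) := by
    rw [conjTranspose_sub, hinv, hPH, hP.eq, Matrix.sub_mul, nonsing_inv_mul Q hdet,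
      Matrix.sub_mul, Matrix.one_mul, Matrix.mul_sub, mul_nonsing_inv_cancel_right Q P hdet,
      two_smul]
    abel
  rw [key]
  exact hQ.posSemidef.conjTranspose_mul_mul_same _

/-- Recursive feasibility: if the convex stability LMI holds for some guesses
`P̄, Λ̄`, then it also holds with the guesses replaced by `Q₁⁻¹` and `Q₂⁻¹`. -/
theorem recursive_feasibility (n m : ℕ)
    (A : Matrix (Fin n) (Fin n) ℝ) (B : Matrix (Fin n) (Fin m) ℝ)
    (C : Matrix (Fin m) (Fin n) ℝ) (D : Matrix (Fin m) (Fin m) ℝ)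
    (ρ : ℝ) (hρ0 : 0 ≤ ρ) (hρ1 : ρ ≤ 1)
    (Q₁ : Matrix (Fin n) (Fin n) ℝ) (hQ₁ : Q₁.PosDef)
    (Q₂ : Matrix (Fin m) (Fin m) ℝ) (hQ₂diag : Q₂.IsDiag) (hQ₂ : Q₂.PosDef)
    (Pb : Matrix (Fin n) (Fin n) ℝ) (hPb : Pb.IsHermitian)
    (Λb : Matrix (Fin m) (Fin m) ℝ) (hΛb : Λb.IsDiag)
    (hLMI : (fromBlocks
        (fromBlocks ((ρ ^ 2) • ((2 : ℝ) • Pb - Pbᵀ * Q₁ * Pb)) 0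
                    0 ((2 : ℝ) • Λb - Λbᵀ * Q₂ * Λb))
        (fromBlocks Aᵀ Cᵀ Bᵀ Dᵀ)
        (fromBlocks A B C D)
        (fromBlocks Q₁ 0 0 Q₂)).PosSemidef) :
    (fromBlocks
        (fromBlocks ((ρ ^ 2) • Q₁⁻¹) 0 0 Q₂⁻¹)
        (fromBlocks Aᵀ Cᵀ Bᵀ Dᵀ)
        (fromBlocks A B C D)
        (fromBlocks Q₁ 0 0 Q₂)).PosSemidef := by
  have hdiff := posSemidef_fromBlocks_diagonal
    (posSemidef_fromBlocks_diagonal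
      ((posSemidef_inv_sub_two_smul_sub hQ₁
        ((conjTranspose_eq_transpose_of_trivial Pb).symm.trans hPb)).smul (sq_nonneg ρ))
      (posSemidef_inv_sub_two_smul_sub hQ₂ hΛb.isSymm))
    (PosSemidef.zero (n := Fin n ⊕ Fin m) (R := ℝ))
  convert hLMI.add hdiff using 1
  simp only [fromBlocks_add, add_zero, ← smul_add, add_sub_cancel]
end

section
/- The nonlinearity Δ(x) = x − sin x lies in the sector [0, 0.41] for x ∈ [−1.4, 1.4]: for every real x with |x| ≤ 1.4, (x − sin x − 0·x)·(0.41·x − (x − sin x)) ≥ 0, i.e. (x − sin x)·(0.41·x − x + sin x) ≥ 0. -/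
/-- The nonlinearity `Δ(x) = x − sin x` lies in the sector `[0, 0.41]` for
`x ∈ [−1.4, 1.4]`. -/
theorem x_sub_sin_sector (x : ℝ) (hx : |x| ≤ 1.4) :
    (x - Real.sin x) * (0.41 * x - x + Real.sin x) ≥ 0 := by
  wlog h : 0 ≤ x generalizing x with H
  · have := H (-x) (by rwa [abs_neg]) (by linarith)
    rw [Real.sin_neg] at this
    linarith
  · rw [abs_of_nonneg h] at hx
    norm_num at hx
    have h_sin := Real.sin_ge_sub_cube h
    have h_sq : x ^ 2 ≤ 2.46 := by norm_num; nlinarith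
    have h_cube : x ^ 3 ≤ 2.46 * x := by nlinarith [mul_le_mul_of_nonneg_right h_sq h]
    exact mul_nonneg (sub_nonneg.mpr (Real.sin_le h)) (by linarith)
end

section
/- The nonlinearity Δ(x) = x − sin x satisfies the time-domain ρ-hard IQC defined by the static filter Ψ = [[0.41, −1], [0, 1]], the matrices M = [[0, λ], [λ, 0]] with λ ≥ 0, and any ρ > 0, on inputs bounded by 1.4: for every sequence p : ℕ → ℝ with |p(k)| ≤ 1.4 for all k, setting q(k) = p(k) − sin(p(k)) and r(k) = (0.41·p(k) − q(k), q(k)) ∈ ℝ², one has ∑_{k=0}^{N} ρ^{−2k}·r(k)ᵀ M r(k) ≥ 0 for every N ∈ ℕ, every λ ≥ 0 and every ρ > 0. -/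
open Matrix

/-- On `[-π/2, π/2]`, the nonlinearity `x - sin x` lies in the sector `[0, 1 - 2/π]`, hence in
`[0, 0.41]`. -/
lemma sector_x_sub_sin {x : ℝ} (hx : |x| ≤ Real.pi / 2) :
    0 ≤ (0.41 * x - (x - Real.sin x)) * (x - Real.sin x) := by
  have key : ∀ y : ℝ, 0 ≤ y → y ≤ Real.pi / 2 →
      0 ≤ (0.41 * y - (y - Real.sin y)) * (y - Real.sin y) := by
    intro y h0 h1
    have hpi : (0.59 : ℝ) ≤ 2 / Real.pi := by
      rw [le_div_iff₀ Real.pi_pos]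
      linarith [Real.pi_lt_d2]
    have hsin : 0.59 * y ≤ Real.sin y :=
      (mul_le_mul_of_nonneg_right hpi h0).trans (Real.mul_le_sin h0 h1)
    exact mul_nonneg (by linarith) (sub_nonneg.2 (Real.sin_le h0))
  obtain ⟨h1, h2⟩ := abs_le.1 hx
  rcases le_total 0 x with h | h
  · exact key x h h2
  · have := key (-x) (by linarith) (by linarith)
    rw [Real.sin_neg] at this
    linarith

/-- The nonlinearity `Δ(x) = x − sin x` satisfies the time-domain ρ-hard IQC
defined by the static filter `Ψ = [[0.41, −1], [0, 1]]`, the matrices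
`M = [[0, λ], [λ, 0]]` with `λ ≥ 0`, and any `ρ > 0`, on inputs bounded by 1.4. -/
theorem x_sub_sin_rho_hard_iqc
    (p : ℕ → ℝ) (hp : ∀ k, |p k| ≤ 1.4)
    (q : ℕ → ℝ) (hq : ∀ k, q k = p k - Real.sin (p k))
    (rs : ℕ → Fin 2 → ℝ) (hrs : ∀ k, rs k = ![0.41 * p k - q k, q k])
    (l : ℝ) (hl : 0 ≤ l) (ρ : ℝ) (hρ : 0 < ρ) :
    ∀ N : ℕ,
      0 ≤ ∑ k ∈ Finset.range (N + 1),
        (ρ ^ (2 * k))⁻¹ * (rs k ⬝ᵥ ((!![0, l; l, 0] : Matrix (Fin 2) (Fin 2) ℝ) *ᵥ rs k)) := by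
  intro N
  refine Finset.sum_nonneg fun k _ => mul_nonneg (by positivity) ?_
  have hpk : |p k| ≤ Real.pi / 2 := (hp k).trans (by linarith [Real.pi_gt_three])
  have hquad : rs k ⬝ᵥ ((!![0, l; l, 0] : Matrix (Fin 2) (Fin 2) ℝ) *ᵥ rs k)
      = 2 * l * ((0.41 * p k - (p k - Real.sin (p k))) * (p k - Real.sin (p k))) := by
    rw [hrs, hq]
    simp [Matrix.mulVec, dotProduct, Fin.sum_univ_two]
    ring
  rw [hquad]
  exact mul_nonneg (by positivity) (sector_x_sub_sin hpk)
end
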